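/- arXiv:2304.02402 — 2 statements merged into one kernel-verified Lean document; each statement's English description precedes it below -/
import Mathlib

section
/- Let μ* be an absolutely continuous probability measure on S¹ and μ₁, …, μ_n probability measures on S¹. For each i let T̃_i := T̃_{μ*}^{μ_i} be the lift of the optimal transport map from μ* to μ_i. Assume that for all i, j = 1, …, n one has ∫₀^{2π} (T̃_i(x) − T̃_j(x))² dμ̃*(x) = W₂²(μ_i, μ_j). Then, setting T̄ := n⁻¹ Σ_{i=1}^n T̃_i, the probability measure (exp_c ∘ T̄ ∘ log_c) # μ* minimizes the Fréchet functional F(ν) := (2n)⁻¹ Σ_{i=1}^n W₂²(ν, μ_i) over all probability measures ν on S¹; that is, it is the Wasserstein barycentre of μ₁, …, μ_n. -/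
open MeasureTheory Real Set Filter Topology

noncomputable section

instance : Fact (0 < 2 * Real.pi) := ⟨by positivity⟩

/-- The circle `ℝ / 2πℤ`. -/
abbrev S1 : Type := AddCircle (2 * Real.pi)

/-- The quotient projection `exp_c : ℝ → S¹`. -/
def expc (x : ℝ) : S1 := (x : S1)

/-- The canonical right inverse `log_c : S¹ → [0, 2π)`. -/
def logc (z : S1) : ℝ := (AddCircle.equivIco (2 * Real.pi) 0 z : ℝ)

/-- Squared 2-Wasserstein distance: infimum of `∫ d(x,y)² dγ` over couplings `γ`. -/
def W2sq {X : Type*} [MeasurableSpace X] [PseudoMetricSpace X]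
    (μ ν : Measure X) : ℝ :=
  sInf { c : ℝ | ∃ γ : Measure (X × X), IsProbabilityMeasure γ ∧
      γ.map Prod.fst = μ ∧ γ.map Prod.snd = ν ∧
      c = ∫ p, dist p.1 p.2 ^ 2 ∂γ }

/-- `T` is an optimal transport map from `μ` to `ν`. -/
def IsOTM (μ ν : Measure S1) (T : S1 → S1) : Prop :=
  Measurable T ∧ μ.map T = ν ∧ (∫ z, dist z (T z) ^ 2 ∂μ) = W2sq μ ν

/-- `μ̃`, the pushforward of a measure on `S¹` to `[0, 2π) ⊆ ℝ` via `log_c`. -/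
def tilde (μ : Measure S1) : Measure ℝ := μ.map logc

/-- The periodic cumulative distribution function of a (periodicised) measure on `[0,2π)`:
`F(x) = μ̃([0,x))` for `x ∈ [0,2π]`, extended by `F(x + 2π) = F(x) + 1`. -/
def cdf (μt : Measure ℝ) (x : ℝ) : ℝ :=
  ⌊x / (2 * π)⌋ + (μt (Set.Ico 0 (Int.fract (x / (2 * π)) * (2 * π)))).toReal

/-- The quantile function (generalized inverse) of the periodic cdf. -/
def qf (μt : Measure ℝ) (u : ℝ) : ℝ := sInf { x : ℝ | u ≤ cdf μt x }

/-- The cost `C_{[μ,ν]}(θ) = ∫₀¹ (F_μ̃⁻(u) − F_ν̃⁻(u−θ))² du`. -/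
def cost (μ ν : Measure S1) (θ : ℝ) : ℝ :=
  ∫ u in (0:ℝ)..1, (qf (tilde μ) u - qf (tilde ν) (u - θ)) ^ 2


/-- `T̃ : ℝ → ℝ` is a lift of an optimal transport map from `μ` to `ν`: it is monotone
nondecreasing, `2π`-periodic-equivariant, has zero average displacement over one period,
and `exp_c ∘ T̃ ∘ log_c` is an optimal transport map from `μ` to `ν`. -/
def IsOTMLift (μ ν : Measure S1) (T : ℝ → ℝ) : Prop :=
  Monotone T ∧ (∀ x : ℝ, T (x + 2 * π) = T x + 2 * π) ∧
    (∫ u in (0:ℝ)..(2 * π), (T u - u)) = 0 ∧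
    IsOTM μ ν (fun z => expc (T (logc z)))

open ProbabilityTheory

lemma measurable_expc : Measurable expc :=
  AddCircle.measurable_mk'

lemma measurable_logc : Measurable logc :=
  measurable_subtype_coe.comp (AddCircle.measurableEquivIco (2 * π) 0).measurable

lemma logc_mem (z : S1) : logc z ∈ Ico 0 (2 * π) := by
  simpa [logc] using (AddCircle.equivIco (2 * π) 0 z).2

lemma expc_sub (x y : ℝ) : expc x - expc y = expc (x - y) := rfl

lemma norm_expc_le (x : ℝ) : ‖expc x‖ ≤ |x| :=
  QuotientAddGroup.norm_mk_le_norm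

lemma dist_expc_le (x y : ℝ) : dist (expc x) (expc y) ≤ |x - y| := by
  rw [dist_eq_norm, expc_sub]
  exact norm_expc_le _

/-- The representative in `[-π, π)` of a point of the circle. -/
def symmLog (z : S1) : ℝ := (AddCircle.equivIco (2 * π) (-π) z : ℝ)

lemma measurable_symmLog : Measurable symmLog :=
  measurable_subtype_coe.comp (AddCircle.measurableEquivIco (2 * π) (-π)).measurable

lemma expc_symmLog (z : S1) : expc (symmLog z) = z :=
  (AddCircle.equivIco (2 * π) (-π)).symm_apply_apply z

lemma abs_symmLog_le (z : S1) : |symmLog z| ≤ π := by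
  have h := (AddCircle.equivIco (2 * π) (-π) z).2
  rw [abs_le]
  exact ⟨h.1, by have := h.2; unfold symmLog; linarith⟩

lemma abs_symmLog (z : S1) : |symmLog z| = ‖z‖ := by
  conv_rhs => rw [← expc_symmLog z]
  refine ((AddCircle.norm_coe_eq_abs_iff (2 * π) two_pi_pos.ne').2 ?_).symm
  rw [abs_of_pos two_pi_pos]
  linarith [abs_symmLog_le z]

lemma dist_le_abs_symmLog_sub (x y z : S1) :
    dist y z ≤ |symmLog (y - x) - symmLog (z - x)| := by
  refine le_trans (le_of_eq ?_) (dist_expc_le _ _)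
  rw [expc_symmLog, expc_symmLog, dist_sub_right]

lemma W2sq_le {X : Type*} [MeasurableSpace X] [PseudoMetricSpace X] {μ ν : Measure X}
    {γ : Measure (X × X)} [IsProbabilityMeasure γ]
    (h₁ : γ.map Prod.fst = μ) (h₂ : γ.map Prod.snd = ν) :
    W2sq μ ν ≤ ∫ p, dist p.1 p.2 ^ 2 ∂γ := by
  refine csInf_le ⟨0, ?_⟩ ⟨γ, inferInstance, h₁, h₂, rfl⟩
  rintro _ ⟨γ, -, -, -, rfl⟩
  exact integral_nonneg fun _ => sq_nonneg _

lemma exists_coupling_lt {X : Type*} [MeasurableSpace X] [PseudoMetricSpace X]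
    (μ ν : Measure X) [IsProbabilityMeasure μ] [IsProbabilityMeasure ν] {ε : ℝ} (hε : 0 < ε) :
    ∃ γ : Measure (X × X), IsProbabilityMeasure γ ∧ γ.map Prod.fst = μ ∧ γ.map Prod.snd = ν ∧
      ∫ p, dist p.1 p.2 ^ 2 ∂γ < W2sq μ ν + ε := by
  obtain ⟨_, ⟨γ, hγ, h₁, h₂, rfl⟩, hlt⟩ := exists_lt_of_csInf_lt
    (s := { c : ℝ | ∃ γ : Measure (X × X), IsProbabilityMeasure γ ∧
      γ.map Prod.fst = μ ∧ γ.map Prod.snd = ν ∧ c = ∫ p, dist p.1 p.2 ^ 2 ∂γ })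
    ⟨_, μ.prod ν, inferInstance, by simp, by simp, rfl⟩ (lt_add_of_pos_right (W2sq μ ν) hε)
  exact ⟨γ, hγ, h₁, h₂, hlt⟩

lemma W2sq_map_le {Ω X : Type*} [MeasurableSpace Ω] [MeasurableSpace X] [PseudoMetricSpace X]
    [OpensMeasurableSpace (X × X)] {P : Measure Ω} [IsProbabilityMeasure P] {f g : Ω → X}
    (hf : Measurable f) (hg : Measurable g) :
    W2sq (P.map f) (P.map g) ≤ ∫ ω, dist (f ω) (g ω) ^ 2 ∂P := by
  have hfg : Measurable fun ω => (f ω, g ω) := hf.prodMk hg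
  have : IsProbabilityMeasure (P.map fun ω => (f ω, g ω)) :=
    Measure.isProbabilityMeasure_map hfg.aemeasurable
  refine (W2sq_le (γ := P.map fun ω => (f ω, g ω)) ?_ ?_).trans_eq ?_
  · rw [Measure.map_map measurable_fst hfg]; rfl
  · rw [Measure.map_map measurable_snd hfg]; rfl
  · exact integral_map hfg.aemeasurable
      (by fun_prop : Continuous fun p : X × X => dist p.1 p.2 ^ 2).measurable.aestronglyMeasurable

/-- Expanding the square of the difference of two independent bounded variables. -/
lemma integral_prod_sub_sq {Ω : Type*} [MeasurableSpace Ω] {P Q : Measure Ω}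
    [IsProbabilityMeasure P] [IsProbabilityMeasure Q] {f : Ω → ℝ} (hf : Measurable f) {C : ℝ}
    (hC : ∀ ω, |f ω| ≤ C) :
    ∫ p : Ω × Ω, (f p.1 - f p.2) ^ 2 ∂(P.prod Q) =
      ∫ x, f x ^ 2 ∂P + ∫ x, f x ^ 2 ∂Q - 2 * ((∫ x, f x ∂P) * ∫ x, f x ∂Q) := by
  have h₁ (R : Measure Ω) [IsProbabilityMeasure R] : Integrable f R :=
    .of_bound hf.aestronglyMeasurable C (.of_forall hC)
  have h₂ (R : Measure Ω) [IsProbabilityMeasure R] : Integrable (fun x => f x ^ 2) R :=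
    .of_bound (hf.pow_const 2).aestronglyMeasurable (C ^ 2) (.of_forall fun x => by
      simpa using pow_le_pow_left₀ (abs_nonneg _) (hC x) 2)
  have h₂fst : Integrable (fun p : Ω × Ω => f p.1 ^ 2) (P.prod Q) := (h₂ P).comp_fst Q
  have h₂snd : Integrable (fun p : Ω × Ω => f p.2 ^ 2) (P.prod Q) := (h₂ Q).comp_snd P
  have e : (fun p : Ω × Ω => (f p.1 - f p.2) ^ 2) =
      fun p => f p.1 ^ 2 + f p.2 ^ 2 - 2 * (f p.1 * f p.2) := by
    ext p; ring
  rw [e, integral_sub (by exact h₂fst.add h₂snd) (((h₁ P).mul_prod (h₁ Q)).const_mul 2),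
    integral_add h₂fst h₂snd, integral_const_mul,
    integral_prod_mul, integral_fun_fst (fun x => f x ^ 2), integral_fun_snd (fun x => f x ^ 2)]
  simp

/-- Gluing couplings of a common measure `ν` with the `μ i` along `ν` bounds the pairwise
Wasserstein distances of the `μ i`. -/
lemma sum_W2sq_le_of_couplings {ι : Type*} [Fintype ι] (ν : Measure S1) [IsProbabilityMeasure ν]
    (μ : ι → Measure S1) (γ : ι → Measure (S1 × S1)) [∀ i, IsProbabilityMeasure (γ i)]
    (h₁ : ∀ i, (γ i).map Prod.fst = ν) (h₂ : ∀ i, (γ i).map Prod.snd = μ i) :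
    ∑ i, ∑ j, W2sq (μ i) (μ j) ≤
      2 * Fintype.card ι * ∑ i, ∫ p, dist p.1 p.2 ^ 2 ∂(γ i) := by
  let κ (i : ι) : Kernel S1 S1 := (γ i).condKernel
  have hγ (i : ι) : ν ⊗ₘ κ i = γ i := by
    have h := (γ i).disintegrate (γ i).condKernel
    rwa [Measure.fst, h₁] at h
  let s (x y : S1) : ℝ := symmLog (y - x)
  have hs : Measurable fun p : S1 × S1 => s p.1 p.2 :=
    measurable_symmLog.comp (by fun_prop : Continuous fun p : S1 × S1 => p.2 - p.1).measurable
  have hsx (x : S1) : Measurable (s x) := hs.comp measurable_prodMk_left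
  have hsC (x y : S1) : |s x y| ≤ π := abs_symmLog_le _
  have hsC' (x y : S1) : |s x y ^ 2| ≤ π ^ 2 := by
    simpa using pow_le_pow_left₀ (abs_nonneg _) (hsC x y) 2
  let m (i : ι) (x : S1) : ℝ := ∫ y, s x y ∂(κ i x)
  let q (i : ι) (x : S1) : ℝ := ∫ y, s x y ^ 2 ∂(κ i x)
  have hsq (i : ι) : Integrable (fun p : S1 × S1 => s p.1 p.2 ^ 2) (ν ⊗ₘ κ i) :=
    .of_bound (hs.pow_const 2).aestronglyMeasurable (π ^ 2) (.of_forall fun p => hsC' _ _)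
  have hq (i : ι) : Integrable (q i) ν := (hsq i).integral_compProd
  have hqγ (i : ι) : ∫ x, q i x ∂ν = ∫ p, dist p.1 p.2 ^ 2 ∂(γ i) := by
    rw [← Measure.integral_compProd (hsq i), hγ]
    refine integral_congr_ae (.of_forall fun p => ?_)
    change symmLog (p.2 - p.1) ^ 2 = dist p.1 p.2 ^ 2
    rw [← sq_abs, abs_symmLog, dist_comm, dist_eq_norm]
  let D (x : S1) (p : S1 × S1) : ℝ := (s x p.1 - s x p.2) ^ 2
  have hD : Measurable fun p : S1 × S1 × S1 => D p.1 p.2 :=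
    ((hs.comp (f := fun p : S1 × S1 × S1 => (p.1, p.2.1)) (by fun_prop)).sub
      (hs.comp (f := fun p : S1 × S1 × S1 => (p.1, p.2.2)) (by fun_prop))).pow_const 2
  have hDint (i j : ι) : Integrable (fun p : S1 × S1 × S1 => D p.1 p.2)
      (ν ⊗ₘ (κ i ×ₖ κ j)) := by
    refine .of_bound hD.aestronglyMeasurable ((2 * π) ^ 2) (.of_forall fun p => ?_)
    rw [Real.norm_eq_abs, abs_pow]
    refine pow_le_pow_left₀ (abs_nonneg _) ((abs_sub _ _).trans ?_) 2
    linarith [hsC p.1 p.2.1, hsC p.1 p.2.2]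
  have hDx (i j : ι) (x : S1) :
      ∫ p, D x p ∂((κ i ×ₖ κ j) x) = q i x + q j x - 2 * (m i x * m j x) := by
    rw [Kernel.prod_apply]
    exact integral_prod_sub_sq (hsx x) (hsC x)
  have hDint' (i j : ι) : Integrable (fun x => q i x + q j x - 2 * (m i x * m j x)) ν := by
    simp_rw [← hDx]
    exact (hDint i j).integral_compProd
  have hW (i j : ι) :
      W2sq (μ i) (μ j) ≤ ∫ x, (q i x + q j x - 2 * (m i x * m j x)) ∂ν := by
    have hpair : (ν ⊗ₘ (κ i ×ₖ κ j)).map Prod.snd = (κ i ×ₖ κ j) ∘ₘ ν :=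
      Measure.snd_compProd ν (κ i ×ₖ κ j)
    have hfst : (ν ⊗ₘ (κ i ×ₖ κ j)).map (fun p => p.2.1) = μ i := by
      rw [← h₂, ← hγ, ← Measure.snd, Measure.snd_compProd ν (κ _)]
      change (ν ⊗ₘ (κ i ×ₖ κ j)).map (Prod.fst ∘ Prod.snd) = _
      rw [← Measure.map_map measurable_fst measurable_snd, hpair,
        Measure.map_comp _ _ measurable_fst, ← Kernel.fst_eq, Kernel.fst_prod]
    have hsnd : (ν ⊗ₘ (κ i ×ₖ κ j)).map (fun p => p.2.2) = μ j := by
      rw [← h₂, ← hγ, ← Measure.snd, Measure.snd_compProd ν (κ _)]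
      change (ν ⊗ₘ (κ i ×ₖ κ j)).map (Prod.snd ∘ Prod.snd) = _
      rw [← Measure.map_map measurable_snd measurable_snd, hpair,
        Measure.map_comp _ _ measurable_snd, ← Kernel.snd_eq, Kernel.snd_prod]
    rw [← hfst, ← hsnd]
    refine (W2sq_map_le (by fun_prop) (by fun_prop)).trans ?_
    simp_rw [← hDx]
    rw [← Measure.integral_compProd (hDint i j)]
    refine integral_mono_of_nonneg (.of_forall fun _ => sq_nonneg _) (hDint i j)
      (.of_forall fun p => ?_)
    simpa [D] using pow_le_pow_left₀ dist_nonneg (dist_le_abs_symmLog_sub p.1 p.2.1 p.2.2) 2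
  calc ∑ i, ∑ j, W2sq (μ i) (μ j)
      ≤ ∑ i, ∑ j, ∫ x, (q i x + q j x - 2 * (m i x * m j x)) ∂ν :=
        Finset.sum_le_sum fun i _ => Finset.sum_le_sum fun j _ => hW i j
    _ = ∫ x, ∑ i, ∑ j, (q i x + q j x - 2 * (m i x * m j x)) ∂ν := by
        rw [integral_finsetSum _ fun i _ => integrable_finsetSum _ fun j _ => hDint' i j]
        exact Finset.sum_congr rfl fun i _ => (integral_finsetSum _ fun j _ => hDint' i j).symm
    _ ≤ ∫ x, 2 * Fintype.card ι * ∑ i, q i x ∂ν := by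
        refine integral_mono (integrable_finsetSum _ fun i _ => integrable_finsetSum _
          fun j _ => hDint' i j) ((integrable_finsetSum _ fun i _ => hq i).const_mul _) fun x => ?_
        have h : ∑ i, ∑ j, (q i x + q j x - 2 * (m i x * m j x)) =
            2 * Fintype.card ι * ∑ i, q i x - 2 * (∑ i, m i x) ^ 2 := by
          simp_rw [Finset.sum_sub_distrib, Finset.sum_add_distrib, ← Finset.mul_sum, sq,
            Finset.sum_mul_sum]
          simp [← Finset.mul_sum]
          ring
        change ∑ i, ∑ j, _ ≤ _
        rw [h]
        linarith [sq_nonneg (∑ i, m i x)]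
    _ = 2 * Fintype.card ι * ∑ i, ∫ p, dist p.1 p.2 ^ 2 ∂(γ i) := by
        rw [integral_const_mul, integral_finsetSum _ fun i _ => hq i]
        simp_rw [hqγ]

/-- The variance bound: pairwise squared Wasserstein distances are controlled by the Fréchet
functional at any measure. -/
lemma sum_W2sq_le {ι : Type*} [Fintype ι] (ν : Measure S1) [IsProbabilityMeasure ν]
    (μ : ι → Measure S1) [∀ i, IsProbabilityMeasure (μ i)] :
    ∑ i, ∑ j, W2sq (μ i) (μ j) ≤ 2 * Fintype.card ι * ∑ i, W2sq ν (μ i) := by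
  set N : ℝ := 2 * Fintype.card ι
  have hN : 0 ≤ N := by positivity
  refine le_of_forall_pos_le_add fun ε hε => ?_
  set δ : ℝ := ε / (N * Fintype.card ι + 1)
  have hδ : 0 < δ := by positivity
  choose γ hγ h₁ h₂ hlt using fun i => exists_coupling_lt ν (μ i) hδ
  calc ∑ i, ∑ j, W2sq (μ i) (μ j)
      ≤ N * ∑ i, ∫ p, dist p.1 p.2 ^ 2 ∂(γ i) := sum_W2sq_le_of_couplings ν μ γ h₁ h₂
    _ ≤ N * ∑ i, (W2sq ν (μ i) + δ) := by
        gcongr with i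
        exact (hlt i).le
    _ = N * ∑ i, W2sq ν (μ i) + N * Fintype.card ι * δ := by
        simp [Finset.sum_add_distrib]; ring
    _ ≤ N * ∑ i, W2sq ν (μ i) + ε := by
        gcongr
        rw [mul_div_assoc', div_le_iff₀ (by positivity)]
        nlinarith

lemma sum_sum_sub_sq {ι : Type*} [Fintype ι] [Nonempty ι] (a : ι → ℝ) :
    2 * Fintype.card ι * ∑ i, ((Fintype.card ι : ℝ)⁻¹ * ∑ k, a k - a i) ^ 2 =
      ∑ i, ∑ j, (a i - a j) ^ 2 := by
  have hc : (Fintype.card ι : ℝ) ≠ 0 := by simp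
  simp_rw [sub_sq, Finset.sum_add_distrib, Finset.sum_sub_distrib, mul_assoc, ← Finset.mul_sum,
    ← Finset.sum_mul]
  simp [← Finset.mul_sum]
  field_simp
  ring

/-- If the lifts `T̃_i` of the optimal transport maps from `μ*` to the
`μ_i` satisfy `‖T̃_i − T̃_j‖²_{L²(μ̃*)} = W₂²(μ_i, μ_j)` for all `i, j`, then the pushforward
of `μ*` by the average map `T̄ = n⁻¹ Σ T̃_i` minimises the Fréchet functional
`ν ↦ (2n)⁻¹ Σ W₂²(ν, μ_i)`, i.e. it is the Wasserstein barycentre of `μ₁, …, μ_n`. -/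
theorem stmt8 (n : ℕ) (hn : 0 < n)
    (μstar : Measure S1) [IsProbabilityMeasure μstar] (hac : μstar ≪ volume)
    (μ : Fin n → Measure S1) [∀ i, IsProbabilityMeasure (μ i)]
    (Tt : Fin n → ℝ → ℝ) (hTt : ∀ i, IsOTMLift μstar (μ i) (Tt i))
    (hiso : ∀ i j, (∫ x, (Tt i x - Tt j x) ^ 2 ∂(tilde μstar)) = W2sq (μ i) (μ j))
    (Tbar : ℝ → ℝ) (hTbar : Tbar = fun x => (n : ℝ)⁻¹ * ∑ i, Tt i x) :
    ∀ ν : Measure S1, IsProbabilityMeasure ν →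
      (1 / (2 * (n : ℝ))) * ∑ i, W2sq (μstar.map (fun z => expc (Tbar (logc z)))) (μ i) ≤
        (1 / (2 * (n : ℝ))) * ∑ i, W2sq ν (μ i) := by
  intro ν hν
  have : Nonempty (Fin n) := ⟨⟨0, hn⟩⟩
  have hn' : (0 : ℝ) < n := by exact_mod_cast hn
  let f (i : Fin n) (z : S1) : ℝ := Tt i (logc z)
  have hf (i : Fin n) : Measurable (f i) := (hTt i).1.measurable.comp measurable_logc
  have hfb (i : Fin n) : ∃ C, ∀ z, |f i z| ≤ C :=
    ⟨max |Tt i 0| |Tt i (2 * π)|, fun z => abs_le_max_abs_abs ((hTt i).1 (logc_mem z).1)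
      ((hTt i).1 (logc_mem z).2.le)⟩
  have hL (i : Fin n) : MemLp (f i) 2 μstar := by
    obtain ⟨C, hC⟩ := hfb i
    exact .of_bound (hf i).aestronglyMeasurable C (.of_forall hC)
  have hbar : (fun z => Tbar (logc z)) = fun z => (n : ℝ)⁻¹ * ∑ i, f i z := by
    rw [hTbar]
  have hbarm : Measurable fun z => Tbar (logc z) := by
    rw [hbar]
    fun_prop
  have hLbar : MemLp (fun z => Tbar (logc z)) 2 μstar := by
    rw [hbar]
    exact (memLp_finsetSum _ fun i _ => hL i).const_mul _
  have hW (i : Fin n) : W2sq (μstar.map (fun z => expc (Tbar (logc z)))) (μ i) ≤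
      ∫ z, (Tbar (logc z) - f i z) ^ 2 ∂μstar := by
    rw [← (hTt i).2.2.2.2.1]
    refine (W2sq_map_le (measurable_expc.comp hbarm) (hTt i).2.2.2.1).trans ?_
    refine integral_mono_of_nonneg (.of_forall fun _ => sq_nonneg _)
      (hLbar.sub (hL i)).integrable_sq (.of_forall fun z => ?_)
    simpa using pow_le_pow_left₀ dist_nonneg (dist_expc_le (Tbar (logc z)) (f i z)) 2
  have hiso' (i j : Fin n) : ∫ z, (f i z - f j z) ^ 2 ∂μstar = W2sq (μ i) (μ j) := by
    rw [← hiso, tilde, integral_map measurable_logc.aemeasurable]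
    exact (((hTt i).1.measurable.sub (hTt j).1.measurable).pow_const 2).aestronglyMeasurable
  have hint' (i : Fin n) : Integrable (fun z => (Tbar (logc z) - f i z) ^ 2) μstar :=
    (hLbar.sub (hL i)).integrable_sq
  have hint (i j : Fin n) : Integrable (fun z => (f i z - f j z) ^ 2) μstar :=
    ((hL i).sub (hL j)).integrable_sq
  have hvar : 2 * (n : ℝ) * ∑ i, ∫ z, (Tbar (logc z) - f i z) ^ 2 ∂μstar =
      ∑ i, ∑ j, W2sq (μ i) (μ j) := by
    rw [← integral_finsetSum _ fun i _ => hint' i, ← integral_const_mul]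
    simp_rw [← hiso']
    rw [Finset.sum_congr rfl fun i _ => (integral_finsetSum _ fun j _ => hint i j).symm,
      ← integral_finsetSum _ fun i _ => integrable_finsetSum _ fun j _ => hint i j]
    refine integral_congr_ae (.of_forall fun z => ?_)
    simpa [hTbar, f] using sum_sum_sub_sq fun i => f i z
  have hlow := sum_W2sq_le ν μ
  rw [Fintype.card_fin, ← hvar] at hlow
  refine mul_le_mul_of_nonneg_left ?_ (by positivity)
  exact (Finset.sum_le_sum fun i _ => hW i).trans (le_of_mul_le_mul_left hlow (by positivity))

end
end

section
/- Let μ be an absolutely continuous probability measure on S¹ and let T : S¹ → S¹ be an optimal transport map from μ to ν := T # μ, with ν absolutely continuous. Then μ({z ∈ S¹ : d_R(z, T(z)) = π}) = 0; that is, an optimal transport map between absolutely continuous measures on S¹ cannot send a set of positive μ-measure to antipodal points. -/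
open MeasureTheory Real Set Filter Topology

noncomputable section

/-- Replacing the transport plan of `T` over a measurable set `A` by the (normalised) product plan
yields another coupling, so an optimal `T` costs no more over `A` than the product plan. -/
theorem mul_setIntegral_dist_sq_le_of_integral_eq_W2sq {X : Type*} [MeasurableSpace X]
    [PseudoMetricSpace X] [SecondCountableTopology X] [BorelSpace X]
    {μ : Measure X} [IsProbabilityMeasure μ] {T : X → X} (hT : Measurable T)
    {D : ℝ} (hD : ∀ x y : X, dist x y ≤ D)
    (hopt : ∫ z, dist z (T z) ^ 2 ∂μ = W2sq μ (μ.map T))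
    {A : Set X} (hA : MeasurableSet A) (hA0 : μ A ≠ 0) :
    μ.real A * ∫ z in A, dist z (T z) ^ 2 ∂μ ≤
      ∫ p, dist p.1 p.2 ^ 2 ∂(μ.restrict A).prod ((μ.restrict A).map T) := by
  have hint (ρ : Measure (X × X)) [IsFiniteMeasure ρ] :
      Integrable (fun p : X × X => dist p.1 p.2 ^ 2) ρ :=
    .of_bound (by fun_prop) (D ^ 2) <| .of_forall fun p => by
      rw [Real.norm_of_nonneg (by positivity)]
      gcongr
      exact hD _ _
  have hgraph : Measurable fun z => (z, T z) := measurable_id.prodMk hT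
  have hmapA : (μ.restrict A).map T univ = μ A := by
    rw [Measure.map_apply hT .univ, preimage_univ, Measure.restrict_apply_univ]
  have hinv : (μ A)⁻¹ * μ A = 1 := ENNReal.inv_mul_cancel hA0 (measure_ne_top _ _)
  set π₀ := (μ.restrict A).prod ((μ.restrict A).map T)
  set γ := (μ.restrict Aᶜ).map (fun z => (z, T z)) + (μ A)⁻¹ • π₀ with hγ
  have hfst : γ.map Prod.fst = μ := by
    rw [hγ, Measure.map_add _ _ measurable_fst, Measure.map_map measurable_fst hgraph,
      Measure.map_smul, Measure.map_fst_prod, hmapA, smul_smul, hinv, one_smul]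
    exact (congrArg (· + _) Measure.map_id).trans (Measure.restrict_compl_add_restrict hA)
  have hsnd : γ.map Prod.snd = μ.map T := by
    rw [hγ, Measure.map_add _ _ measurable_snd, Measure.map_map measurable_snd hgraph,
      Measure.map_smul, Measure.map_snd_prod, Measure.restrict_apply_univ, smul_smul, hinv,
      one_smul]
    change (μ.restrict Aᶜ).map T + _ = _
    rw [← Measure.map_add _ _ hT, Measure.restrict_compl_add_restrict hA]
  have hprob : IsProbabilityMeasure γ := by
    refine ⟨?_⟩
    rw [← preimage_univ (f := Prod.fst), ← Measure.map_apply measurable_fst .univ, hfst,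
      measure_univ]
  have hle : W2sq μ (μ.map T) ≤ ∫ p, dist p.1 p.2 ^ 2 ∂γ := by
    refine csInf_le ⟨0, ?_⟩ ⟨γ, hprob, hfst, hsnd, rfl⟩
    rintro _ ⟨ρ, -, -, -, rfl⟩
    exact integral_nonneg fun p => by positivity
  have hintT : Integrable (fun z => dist z (T z) ^ 2) μ :=
    (hint (μ.map fun z => (z, T z))).comp_measurable hgraph
  have hcost : ∫ p, dist p.1 p.2 ^ 2 ∂γ =
      ∫ z in Aᶜ, dist z (T z) ^ 2 ∂μ + (μ.real A)⁻¹ * ∫ p, dist p.1 p.2 ^ 2 ∂π₀ := by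
    rw [hγ, integral_add_measure (hint _)
      ((hint _).smul_measure (ENNReal.inv_ne_top.mpr hA0)), integral_smul_measure,
      integral_map hgraph.aemeasurable (by fun_prop), ENNReal.toReal_inv, smul_eq_mul]
    rfl
  rw [← hopt, hcost, ← integral_add_compl hA hintT, add_comm, add_le_add_iff_left] at hle
  have hpos : 0 < μ.real A := ENNReal.toReal_pos hA0 (measure_ne_top _ _)
  rwa [le_inv_mul_iff₀ hpos] at hle

theorem S1.dist_le_pi (x y : S1) : dist x y ≤ π := by
  have h := AddCircle.norm_le_half_period (2 * π) (x := x - y) (by positivity)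
  rwa [← dist_eq_norm, abs_of_pos (by positivity), mul_div_cancel_left₀ _ two_ne_zero] at h

theorem S1.volume_sphere (x : S1) (r : ℝ) : volume (Metric.sphere x r) = 0 := by
  rw [← Metric.closedBall_sdiff_ball]
  exact ae_le_set.mp AddCircle.closedBall_ae_eq_ball.le

/-- An optimal transport map between absolutely continuous measures on
`S¹` cannot send a set of positive measure to antipodal points: `μ{z : d_R(z,T(z)) = π} = 0`. -/
theorem stmt11 (μ : Measure S1) [IsProbabilityMeasure μ] (hacμ : μ ≪ volume)
    (T : S1 → S1) (hacν : μ.map T ≪ volume)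
    (hopt : IsOTM μ (μ.map T) T) :
    μ { z : S1 | dist z (T z) = π } = 0 := by
  obtain ⟨hT, -, hcost⟩ := hopt
  set A := { z : S1 | dist z (T z) = π }
  have hA : MeasurableSet A :=
    measurableSet_eq_fun (measurable_id.dist hT) measurable_const
  by_contra hA0
  have hle := mul_setIntegral_dist_sq_le_of_integral_eq_W2sq hT S1.dist_le_pi hcost hA hA0
  set α := μ.restrict A with hα
  have hα0 : α ≠ 0 := by rwa [hα, Ne, Measure.restrict_eq_zero]
  have : NeZero α := ⟨hα0⟩
  have hreal : (α.prod (α.map T)).real univ = μ.real A * μ.real A := by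
    rw [← univ_prod_univ, measureReal_prod_prod, map_measureReal_apply hT .univ, preimage_univ,
      hα, measureReal_restrict_apply_univ]
  have hconst : ∫ z in A, dist z (T z) ^ 2 ∂μ = μ.real A * π ^ 2 := by
    rw [setIntegral_congr_fun hA (g := fun _ => π ^ 2) fun z hz =>
        congrArg (· ^ 2) (show dist z (T z) = π from hz),
      setIntegral_const, smul_eq_mul]
  have hint : Integrable (fun p : S1 × S1 => dist p.1 p.2 ^ 2) (α.prod (α.map T)) :=
    .of_bound (by fun_prop) (π ^ 2) <| .of_forall fun p => by
      rw [Real.norm_of_nonneg (by positivity)]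
      gcongr
      exact S1.dist_le_pi _ _
  have hnonneg (p : S1 × S1) : 0 ≤ π ^ 2 - dist p.1 p.2 ^ 2 :=
    sub_nonneg.mpr (by gcongr; exact S1.dist_le_pi _ _)
  have hzero : ∫ p, (π ^ 2 - dist p.1 p.2 ^ 2) ∂α.prod (α.map T) = 0 := by
    refine le_antisymm ?_ (integral_nonneg hnonneg)
    rw [integral_sub (integrable_const _) hint, integral_const, hreal, smul_eq_mul]
    rw [hconst] at hle
    linarith
  rw [integral_eq_zero_iff_of_nonneg hnonneg ((integrable_const _).sub hint)] at hzero
  obtain ⟨z, hz⟩ := (Measure.ae_ae_of_ae_prod hzero).exists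
  have hsphere : ∀ᵐ w ∂α.map T, w ∈ Metric.sphere z π := by
    filter_upwards [hz] with w hw
    rw [Metric.mem_sphere']
    exact ((pow_left_inj₀ pi_nonneg dist_nonneg two_ne_zero).mp (sub_eq_zero.mp hw)).symm
  have hac : α.map T ≪ volume := (Measure.restrict_le_self.absolutelyContinuous.map hT).trans hacν
  have hnotin : ∀ᵐ w ∂α.map T, w ∉ Metric.sphere z π :=
    measure_eq_zero_iff_ae_notMem.mp (hac (S1.volume_sphere z π))
  have : NeZero (α.map T) := ⟨(Measure.map_ne_zero_iff hT.aemeasurable).mpr hα0⟩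
  obtain ⟨w, hw, hw'⟩ := (hsphere.and hnotin).exists
  exact hw' hw

end
end
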